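/- arXiv:2301.07948 — 4 statements merged into one kernel-verified Lean document; each statement's English description precedes it below -/
import Mathlib

section
/- Let R be a ring that is weakly 2-primal (the set Nil(R) of nilpotent elements of R is a two-sided ideal which is locally nilpotent, i.e., for every finite subset S of Nil(R) there exists a positive integer N such that every product of N elements of S equals 0) and periodic. If G is a locally finite group, then the group ring RG (the monoid algebra MonoidAlgebra R G) is a periodic ring. -/
/-- A ring `R` is *periodic* if for every `x ∈ R` there exist positive integers
`m > n` with `x ^ m = x ^ n`. -/
def IsPeriodicRing (R : Type*) [Ring R] : Prop :=
  ∀ x : R, ∃ m n : ℕ, 0 < n ∧ n < m ∧ x ^ m = x ^ n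

/-- A ring `R` is *weakly 2-primal* if the set of nilpotent elements of `R` is a
two-sided ideal which is locally nilpotent: for every finite subset `S` of nilpotents,
there is a positive integer `N` such that every product of `N` elements of `S` is `0`. -/
def IsWeakly2Primal (R : Type*) [Ring R] : Prop :=
  (∃ I : TwoSidedIdeal R, ∀ x : R, x ∈ I ↔ IsNilpotent x) ∧
  (∀ S : Finset R, (∀ x ∈ S, IsNilpotent x) →
    ∃ N : ℕ, 0 < N ∧ ∀ l : List R, (∀ x ∈ l, x ∈ S) → l.length = N → l.prod = 0)

theorem Submonoid.finite_powers_of_pow_eq_pow {M : Type*} [Monoid M] {x : M} {m n : ℕ}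
    (hnm : n < m) (h : x ^ m = x ^ n) : (Submonoid.powers x : Set M).Finite := by
  refine ((Set.finite_lt_nat m).image (x ^ ·)).subset ?_
  rintro _ ⟨k, rfl⟩
  induction k using Nat.strong_induction_on with
  | _ k ih =>
    rcases lt_or_ge k m with hk | hk
    · exact ⟨k, hk, rfl⟩
    · have : x ^ k = x ^ (k - m + n) := by
        rw [pow_add, ← h, ← pow_add, Nat.sub_add_cancel hk]
      simpa only [this] using ih (k - m + n) (by lia)

theorem Submonoid.finite_powers_of_isOfFinOrder {M : Type*} [Monoid M] {x : M}
    (hx : IsOfFinOrder x) : (Submonoid.powers x : Set M).Finite :=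
  finite_powers_of_pow_eq_pow hx.orderOf_pos ((pow_orderOf_eq_one x).trans (pow_zero x).symm)

theorem exists_pow_eq_pow_of_mem_finite {M : Type*} [Monoid M] {x : M} {s : Set M}
    (hs : s.Finite) (hx : ∀ k : ℕ, x ^ k ∈ s) : ∃ m n : ℕ, 0 < n ∧ n < m ∧ x ^ m = x ^ n := by
  obtain ⟨i, hi, j, -, hij, h⟩ := (Set.Ioi_infinite 0).exists_lt_map_eq_of_mapsTo
    (f := fun k : ℕ => x ^ k) (fun k _ => hx k) hs
  exact ⟨j, i, hi, hij, h.symm⟩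

theorem Submonoid.finite_closure_of_comm {M : Type*} [Monoid M] (hcomm : ∀ x y : M, x * y = y * x)
    (hfin : ∀ x : M, (Submonoid.powers x : Set M).Finite) {s : Set M} (hs : s.Finite) :
    (Submonoid.closure s : Set M).Finite := by
  induction s, hs using Set.Finite.induction_on with
  | empty => simp
  | @insert a s _ _ ih =>
    refine ((hfin a).mul ih).subset fun x hx => ?_
    induction hx using Submonoid.closure_induction_left with
    | one => exact ⟨1, one_mem _, 1, one_mem _, one_mul 1⟩
    | mul_left x hx y hy ih =>
      obtain ⟨u, hu, v, hv, rfl⟩ := ih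
      rcases hx with rfl | hx
      · exact ⟨x * u, mul_mem (mem_powers x) hu, v, hv, mul_assoc x u v⟩
      · refine ⟨u, hu, x * v, mul_mem (subset_closure hx) hv, ?_⟩
        simp only [← mul_assoc, hcomm x u]

open Polynomial in
/-- If a product of linear factors in an endomorphism kills a nonzero vector, then one of the
roots is an eigenvalue. -/
theorem Module.End.exists_eigenvector_of_aeval_prod_X_sub_C {F M : Type*} [CommRing F]
    [AddCommGroup M] [Module F M] (f : Module.End F M) (T : Finset F) {v : M} (hv : v ≠ 0)
    (h : aeval f (∏ r ∈ T, (X - C r)) v = 0) : ∃ r ∈ T, ∃ w : M, w ≠ 0 ∧ f w = r • w := by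
  classical
  induction T using Finset.induction_on with
  | empty => simp [hv] at h
  | insert r T hr ih =>
    by_cases hw : aeval f (∏ r ∈ T, (X - C r)) v = 0
    · obtain ⟨s, hs, w, hw⟩ := ih hw
      exact ⟨s, Finset.mem_insert_of_mem hs, w, hw⟩
    · refine ⟨r, Finset.mem_insert_self r T, _, hw, ?_⟩
      rw [Finset.prod_insert hr, map_mul, Module.End.mul_apply] at h
      simpa [sub_eq_zero] using h

open Polynomial in
/-- In a domain, a noncentral element `a` of finite order admits a nonzero `b` with
`b * a = a ^ i * b` and `a ^ i ≠ a`. -/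
theorem exists_mul_eq_pow_mul_of_isOfFinOrder {D : Type*} [Ring D] [IsDomain D] {a d : D}
    (ha : IsOfFinOrder a) (hd : d * a ≠ a * d) :
    ∃ b : D, b ≠ 0 ∧ ∃ i : ℕ, a ^ i ≠ a ∧ b * a = a ^ i * b := by
  classical
  let A := Subring.centralizer ({a} : Set D)
  let F := Subring.center A
  have hA : ∀ x : A, a * x = x * a := fun x => Subring.mem_centralizer_iff.1 x.2 a rfl
  let z : F := ⟨⟨a, by simp [A, Subring.mem_centralizer_iff]⟩,
    Subring.mem_center_iff.2 fun x => Subtype.ext (hA x).symm⟩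
  have hz : ∀ i : ℕ, (((z ^ i : F) : A) : D) = a ^ i := fun i => rfl
  let f : Module.End F D :=
    { toFun := fun x => x * a
      map_add' := fun x y => add_mul x y a
      map_smul' := fun r x => mul_assoc ((r : A) : D) x a }
  have hinj : Function.Injective fun x : F => ((x : A) : D) :=
    Subtype.val_injective.comp Subtype.val_injective
  have hprim : IsPrimitiveRoot z (orderOf a) := by
    refine ⟨hinj ?_, fun l hl => orderOf_dvd_of_pow_eq_one ?_⟩
    · exact pow_orderOf_eq_one a
    · exact congrArg (fun x : F => ((x : A) : D)) hl
  have hpos : 0 < orderOf a := ha.orderOf_pos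
  have : NeZero (orderOf a) := ⟨hpos.ne'⟩
  have hfpow : ∀ (k : ℕ) (x : D), (f ^ k) x = x * a ^ k := by
    intro k
    induction k with
    | zero => simp
    | succ k ih =>
      intro x
      rw [pow_succ', Module.End.mul_apply, ih, pow_succ, ← mul_assoc]
      rfl
  have hann : aeval f (X ^ orderOf a - 1 : F[X]) d = 0 := by
    simp [hfpow, pow_orderOf_eq_one]
  have hmem : z ∈ nthRootsFinset (orderOf a) (1 : F) := hprim.mem_nthRootsFinset hpos
  rw [X_pow_sub_one_eq_prod hpos hprim, ← Finset.prod_erase_mul _ _ hmem, map_mul,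
    Module.End.mul_apply] at hann
  have hv : aeval f (X - C z) d ≠ 0 := by
    have : aeval f (X - C z) d = d * a - a * d := by
      simp only [map_sub, aeval_X, aeval_C]
      rfl
    rw [this]
    exact sub_ne_zero.2 hd
  obtain ⟨r, hr, b, hb, hfb⟩ := f.exists_eigenvector_of_aeval_prod_X_sub_C _ hv hann
  rw [Finset.mem_erase, mem_nthRootsFinset hpos] at hr
  obtain ⟨i, -, rfl⟩ := hprim.eq_pow_of_pow_eq_one hr.2
  exact ⟨b, hb, i, fun h => hr.1 (hinj h), hfb⟩

/-- A finitely generated additive subgroup of a ring of positive characteristic is finite. -/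
theorem Submodule.finite_of_fg_of_natCast_eq_zero {A : Type*} [Ring A] {c : ℕ} (hc : 0 < c)
    (h : (c : A) = 0) {N : Submodule ℤ A} (hN : N.FG) : (N : Set A).Finite := by
  have : Module.Finite ℤ N := Module.Finite.iff_fg.2 hN
  have htors : Module.IsTorsion ℤ N := fun {x} =>
    ⟨⟨c, mem_nonZeroDivisors_of_ne_zero (by exact_mod_cast hc.ne')⟩, Subtype.ext (by
      change (c : ℤ) • (x : A) = 0
      simp [h])⟩
  exact Module.finite_of_fg_torsion N htors

theorem Subring.finite_closure_of_finite_submonoidClosure {A : Type*} [Ring A] {c : ℕ} (hc : 0 < c)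
    (h : (c : A) = 0) {s : Set A} (hs : (Submonoid.closure s : Set A).Finite) :
    (Subring.closure s : Set A).Finite := by
  refine (Submodule.finite_of_fg_of_natCast_eq_zero hc h
    (Submodule.fg_span (R := ℤ) hs)).subset fun x hx => ?_
  rw [SetLike.mem_coe, Subring.mem_closure_iff] at hx
  exact (AddSubgroup.closure_le (Submodule.span ℤ _).toAddSubgroup).2 Submodule.subset_span hx

/-- A domain of positive characteristic whose nonzero elements have finite order is commutative. -/
theorem mul_comm_of_isOfFinOrder {D : Type*} [Ring D] [IsDomain D] {c : ℕ} (hc : 0 < c)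
    (h : (c : D) = 0) (hD : ∀ a : D, a ≠ 0 → IsOfFinOrder a) (a d : D) : d * a = a * d := by
  by_contra hd
  have ha : IsOfFinOrder a := hD a (by rintro rfl; simp at hd)
  obtain ⟨b, hb, i, hi, hba⟩ := exists_mul_eq_pow_mul_of_isOfFinOrder ha hd
  have hpow : ∀ j : ℕ, b * a ^ j = (a ^ i) ^ j * b := fun j => (SemiconjBy.pow_right hba j)
  have hfin : (Submonoid.closure {a, b} : Set D).Finite := by
    refine ((Submonoid.finite_powers_of_isOfFinOrder ha).mul
      (Submonoid.finite_powers_of_isOfFinOrder (hD b hb))).subset fun x hx => ?_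
    induction hx using Submonoid.closure_induction_left with
    | one => exact ⟨1, one_mem _, 1, one_mem _, one_mul 1⟩
    | mul_left x hx y hy ih =>
      obtain ⟨_, ⟨j, rfl⟩, _, ⟨k, rfl⟩, rfl⟩ := ih
      rcases hx with rfl | rfl
      · exact ⟨_, ⟨j + 1, rfl⟩, _, ⟨k, rfl⟩, by simp [pow_succ', mul_assoc]⟩
      · refine ⟨_, ⟨i * j, rfl⟩, _, ⟨k + 1, rfl⟩, ?_⟩
        simp only [pow_mul, pow_succ', ← mul_assoc, hpow]
  have : Finite (Subring.closure {a, b}) :=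
    Subring.finite_closure_of_finite_submonoidClosure hc h hfin
  have hcomm := (Finite.isDomain_to_isField (Subring.closure {a, b})).mul_comm
    ⟨b, Subring.subset_closure (by simp)⟩ ⟨a, Subring.subset_closure (by simp)⟩
  have hcomm' : b * a = a * b := congrArg Subtype.val hcomm
  exact hi (mul_right_cancel₀ hb (hba.symm.trans hcomm'))

theorem isReduced_of_forall_pow_eq_self {S : Type*} [Ring S]
    (hS : ∀ x : S, ∃ n : ℕ, x ^ (n + 2) = x) : IsReduced S := by
  refine (isReduced_iff_pow_one_lt 2 one_lt_two).2 fun x hx => ?_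
  obtain ⟨n, hn⟩ := hS x
  rw [← hn, pow_add, hx, mul_zero]

theorem IsIdempotentElem.commute_of_isReduced {S : Type*} [Ring S] [IsReduced S] {e : S}
    (he : IsIdempotentElem e) (r : S) : e * r = r * e := by
  have hsq := (isReduced_iff_pow_one_lt (R := S) 2 one_lt_two).1 inferInstance
  have hleft : e * r * (1 - e) = 0 := hsq _ <| by
    calc (e * r * (1 - e)) ^ 2 = e * r * ((1 - e) * e) * r * (1 - e) := by noncomm_ring
      _ = 0 := by rw [he.one_sub_mul_self]; simp
  have hright : (1 - e) * r * e = 0 := hsq _ <| by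
    calc ((1 - e) * r * e) ^ 2 = (1 - e) * r * (e * (1 - e)) * r * e := by noncomm_ring
      _ = 0 := by rw [he.mul_one_sub_self]; simp
  rw [mul_sub, mul_one, sub_eq_zero] at hleft
  rw [sub_mul, sub_mul, one_mul, sub_eq_zero] at hright
  exact hleft.trans hright.symm

/-- **Jacobson commutativity theorem** for rings of positive characteristic: if every element
satisfies `x ^ n = x` for some `n > 1`, then the ring is commutative. -/
theorem mul_comm_of_forall_pow_eq_self {S : Type*} [Ring S] {c : ℕ} (hc : 0 < c)
    (h : (c : S) = 0) (hS : ∀ x : S, ∃ n : ℕ, x ^ (n + 2) = x) (x y : S) : x * y = y * x := by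
  by_contra hxy
  have := isReduced_of_forall_pow_eq_self hS
  have hidem : ∀ {a : S} {n : ℕ}, a ^ (n + 2) = a → IsIdempotentElem (a ^ (n + 1)) := by
    intro a n ha
    rw [IsIdempotentElem, ← pow_add, show n + 1 + (n + 1) = n + (n + 2) by ring, pow_add, ha,
      pow_succ]
  obtain ⟨n, hn⟩ := hS (x * y - y * x)
  set w := x * y - y * x
  have hw : w ≠ 0 := sub_ne_zero.2 hxy
  have hI : Ideal.span {1 - w ^ (n + 1)} ≠ ⊤ := by
    rw [Ne, Ideal.eq_top_iff_one, Ideal.mem_span_singleton']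
    rintro ⟨r, hr⟩
    apply hw
    calc w = r * (1 - w ^ (n + 1)) * w := by rw [hr, one_mul]
      _ = r * (w - w ^ (n + 2)) := by rw [mul_assoc, sub_mul, one_mul, ← pow_succ]
      _ = 0 := by rw [hn, sub_self, mul_zero]
  obtain ⟨P, hP, hIP⟩ := Ideal.exists_le_maximal _ hI
  have : P.IsTwoSided := by
    refine ⟨fun {a} b ha => ?_⟩
    obtain ⟨k, hk⟩ := hS a
    have : a * b = a * b * a ^ k * a := by
      calc a * b = a ^ (k + 1) * (a * b) := by rw [← mul_assoc, ← pow_succ, hk]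
        _ = a * b * a ^ k * a := by rw [(hidem hk).commute_of_isReduced, pow_succ, mul_assoc _ _ a]
    rw [this]
    exact P.mul_mem_left _ ha
  let π := Ideal.Quotient.mk P
  have hinv : ∀ a : S ⧸ P, a ≠ 0 → ∃ k : ℕ, a ^ (k + 1) = 1 := by
    intro a ha
    obtain ⟨a, rfl⟩ := Ideal.Quotient.mk_surjective a
    obtain ⟨k, hk⟩ := hS a
    obtain ⟨r, i, hi, hri⟩ := hP.exists_inv (x := a) (by
      rwa [Ne, Ideal.Quotient.eq_zero_iff_mem] at ha)
    have hra : π r * π a = 1 := by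
      rw [← map_mul, ← map_one π, ← hri, map_add, Ideal.Quotient.eq_zero_iff_mem.2 hi, add_zero]
    refine ⟨k, ?_⟩
    calc π a ^ (k + 1) = π r * π a * π a ^ (k + 1) := by rw [hra, one_mul]
      _ = π r * π (a ^ (k + 2)) := by rw [mul_assoc, ← pow_succ', map_pow]
      _ = 1 := by rw [hk, hra]
  have : Nontrivial (S ⧸ P) := Ideal.Quotient.nontrivial_iff.2 hP.ne_top
  have : NoZeroDivisors (S ⧸ P) := by
    refine ⟨fun {a b} hab => or_iff_not_imp_left.2 fun ha => ?_⟩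
    obtain ⟨k, hk⟩ := hinv a ha
    rw [← one_mul b, ← hk, pow_succ, mul_assoc, hab, mul_zero]
  have : IsDomain (S ⧸ P) := NoZeroDivisors.to_isDomain _
  have hcomm := mul_comm_of_isOfFinOrder (D := S ⧸ P) hc (by simpa using congrArg π h)
    (fun a ha => isOfFinOrder_iff_pow_eq_one.2
      (let ⟨k, hk⟩ := hinv a ha; ⟨k + 1, k.succ_pos, hk⟩)) (π y) (π x)
  have hwP : w ∈ P := by
    rw [← Ideal.Quotient.eq_zero_iff_mem, map_sub, map_mul, map_mul]
    exact sub_eq_zero.2 hcomm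
  apply hP.ne_top
  rw [Ideal.eq_top_iff_one, ← sub_add_cancel 1 (w ^ (n + 1))]
  refine P.add_mem (hIP (Ideal.subset_span rfl)) ?_
  rw [pow_succ]
  exact P.mul_mem_left _ hwP

namespace MonoidAlgebra

/-- Over a ring of positive characteristic, the monomials with coefficients in a finite
multiplicative submonoid and support in a finite submonoid generate a finite subring. -/
theorem finite_closure_single {S G : Type*} [Ring S] [Monoid G] {c : ℕ} (hc : 0 < c)
    (h : (c : S) = 0) (M : Submonoid S) (H : Submonoid G) (hM : (M : Set S).Finite)
    (hH : (H : Set G).Finite) :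
    (Subring.closure (Set.image2 single (H : Set G) (M : Set S)) :
      Set (MonoidAlgebra S G)).Finite := by
  refine Subring.finite_closure_of_finite_submonoidClosure hc
    (by rw [natCast_def, h, single_zero]) ((hH.image2 single hM).subset fun x hx => ?_)
  induction hx using Submonoid.closure_induction with
  | mem x hx => exact hx
  | one => exact ⟨1, one_mem H, 1, one_mem M, rfl⟩
  | mul x y _ _ hx hy =>
    obtain ⟨g, hg, r, hr, rfl⟩ := hx
    obtain ⟨g', hg', r', hr', rfl⟩ := hy
    exact ⟨g * g', mul_mem hg hg', r * r', mul_mem hr hr', (single_mul_single ..).symm⟩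

theorem isPeriodicRing_of_comm {S G : Type*} [Ring S] [Group G] {c : ℕ} (hc : 0 < c)
    (h : (c : S) = 0) (hcomm : ∀ x y : S, x * y = y * x) (hS : IsPeriodicRing S)
    (hG : ∀ s : Finset G, ((Subgroup.closure (s : Set G) : Subgroup G) : Set G).Finite) :
    IsPeriodicRing (MonoidAlgebra S G) := by
  classical
  intro x
  let M := Submonoid.closure (x.coeff.support.image x.coeff : Set S)
  have hM : (M : Set S).Finite := Submonoid.finite_closure_of_comm hcomm
    (fun a => let ⟨_, _, _, hnm, ha⟩ := hS a; Submonoid.finite_powers_of_pow_eq_pow hnm ha)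
    (Finset.finite_toSet _)
  let H := Subgroup.closure (x.coeff.support : Set G)
  refine exists_pow_eq_pow_of_mem_finite
    (finite_closure_single hc h M H.toSubmonoid hM (hG _)) fun k => pow_mem ?_ k
  rw [← sum_coeff_single x]
  refine sum_mem fun g hg => Subring.subset_closure ⟨g, Subgroup.subset_closure hg, _,
    Submonoid.subset_closure ?_, rfl⟩
  exact Finset.mem_coe.2 (Finset.mem_image_of_mem _ hg)

open scoped Pointwise in
/-- Over a weakly 2-primal ring, an element with nilpotent coefficients is nilpotent. -/
theorem isNilpotent_of_forall_isNilpotent_coeff {R G : Type*} [Ring R] [Monoid G]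
    (hR : IsWeakly2Primal R) {x : MonoidAlgebra R G} (hx : ∀ g, IsNilpotent (x.coeff g)) :
    IsNilpotent x := by
  classical
  let s := x.coeff.support.image x.coeff
  obtain ⟨N, -, hN⟩ := hR.2 s (by simpa [s] using fun g _ => hx g)
  let T : Set (MonoidAlgebra R G) := Set.image2 single Set.univ s
  have hT : ∀ k : ℕ, ∀ y ∈ T ^ k, ∃ (g : G) (l : List R),
      (∀ r ∈ l, r ∈ s) ∧ l.length = k ∧ y = single g l.prod := by
    intro k
    induction k with
    | zero =>
      intro y hy
      exact ⟨1, [], by simp, rfl, by simpa [one_def] using hy⟩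
    | succ k ih =>
      rw [pow_succ']
      rintro _ ⟨_, ⟨g, -, r, hr, rfl⟩, y, hy, rfl⟩
      obtain ⟨g', l, hl, hlen, rfl⟩ := ih y hy
      exact ⟨g * g', r :: l, by simpa using ⟨by simpa using hr, hl⟩, by simp [hlen], by simp⟩
  have hxT : x ∈ Submodule.span ℤ T := by
    rw [← sum_coeff_single x]
    exact sum_mem fun g hg => Submodule.subset_span
      ⟨g, trivial, _, Finset.mem_coe.2 (Finset.mem_image_of_mem _ hg), rfl⟩
  have hpow := Submodule.pow_mem_pow _ hxT N
  rw [Submodule.span_pow, Submodule.span_eq_bot.2] at hpow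
  · exact ⟨N, hpow⟩
  · intro y hy
    obtain ⟨g, l, hl, hlen, rfl⟩ := hT N y hy
    rw [hN l hl hlen, single_zero]

end MonoidAlgebra

theorem IsPeriodicRing.exists_natCast_eq_zero {R : Type*} [Ring R] (hR : IsPeriodicRing R) :
    ∃ c : ℕ, 0 < c ∧ (c : R) = 0 := by
  obtain ⟨m, n, -, hnm, h⟩ := hR 2
  have hlt : 2 ^ n < 2 ^ m := Nat.pow_lt_pow_right one_lt_two hnm
  refine ⟨2 ^ m - 2 ^ n, Nat.sub_pos_of_lt hlt, ?_⟩
  rw [Nat.cast_sub hlt.le]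
  push_cast
  exact sub_eq_zero.2 h

open Polynomial in
/-- In a ring of positive characteristic, an element that is periodic up to a nilpotent is
periodic. -/
theorem exists_pow_eq_pow_of_isNilpotent_sub {A : Type*} [Ring A] {c : ℕ} (hc : 0 < c)
    (h : (c : A) = 0) {x : A} {m n : ℕ} (hnm : n < m) (hx : IsNilpotent (x ^ m - x ^ n)) :
    ∃ m n : ℕ, 0 < n ∧ n < m ∧ x ^ m = x ^ n := by
  obtain ⟨k, hk⟩ := hx
  have hint : IsIntegral ℤ x := by
    refine ⟨(X ^ m - X ^ n) ^ k, (monic_X_pow_sub (by simpa using hnm)).pow k, ?_⟩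
    rw [← aeval_def]
    simpa using hk
  exact exists_pow_eq_pow_of_mem_finite
    (Submodule.finite_of_fg_of_natCast_eq_zero hc h hint.fg_adjoin_singleton)
    fun k => pow_mem (Algebra.self_mem_adjoin_singleton ℤ x) k

theorem IsPeriodicRing.exists_isNilpotent_pow_sub_self {R : Type*} [Ring R]
    (hR : IsPeriodicRing R) (x : R) : ∃ n : ℕ, IsNilpotent (x ^ (n + 2) - x) := by
  obtain ⟨m, n, hn, hnm, h⟩ := hR x
  obtain ⟨d, rfl⟩ := Nat.exists_eq_add_of_lt hnm
  refine ⟨d, n, ?_⟩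
  have hfac : x ^ (d + 2) - x = x * (x ^ (d + 1) - 1) := by
    rw [mul_sub, mul_one, ← pow_succ']
  have hcomm : Commute x (x ^ (d + 1) - 1) :=
    ((Commute.refl x).pow_right _).sub_right (Commute.one_right x)
  have hzero : x ^ n * (x ^ (d + 1) - 1) = 0 := by
    rw [mul_sub, mul_one, ← pow_add, ← add_assoc, h, sub_self]
  obtain ⟨k, rfl⟩ := Nat.exists_eq_succ_of_ne_zero hn.ne'
  rw [hfac, hcomm.mul_pow, pow_succ' (x ^ (d + 1) - 1), ← mul_assoc, hzero, zero_mul]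

/-- If `R` is a weakly 2-primal periodic ring and `G` is a locally finite group, then
the group ring `RG` is periodic. -/
theorem periodic_monoidAlgebra_of_weakly2Primal_of_locallyFinite
    (R : Type*) [Ring R] (G : Type*) [Group G]
    (h2p : IsWeakly2Primal R) (hper : IsPeriodicRing R)
    (hG : ∀ s : Finset G, ((Subgroup.closure (s : Set G) : Subgroup G) : Set G).Finite) :
    IsPeriodicRing (MonoidAlgebra R G) := by
  intro x
  obtain ⟨c, hc, hcR⟩ := hper.exists_natCast_eq_zero
  obtain ⟨I, hI⟩ := h2p.1
  let π := Ideal.Quotient.mk I.asIdeal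
  have hπ : ∀ r : R, π r = 0 ↔ IsNilpotent r := fun r => by
    rw [Ideal.Quotient.eq_zero_iff_mem, TwoSidedIdeal.mem_asIdeal, hI]
  have hcQ : (c : R ⧸ I.asIdeal) = 0 := by simpa using congrArg π hcR
  have hcomm := mul_comm_of_forall_pow_eq_self hc hcQ fun y => by
    obtain ⟨r, rfl⟩ := Ideal.Quotient.mk_surjective y
    obtain ⟨n, hn⟩ := hper.exists_isNilpotent_pow_sub_self r
    exact ⟨n, sub_eq_zero.1 (by simpa using (hπ _).2 hn)⟩
  have hperQ : IsPeriodicRing (R ⧸ I.asIdeal) := fun y => by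
    obtain ⟨r, rfl⟩ := Ideal.Quotient.mk_surjective y
    obtain ⟨m, n, hn, hnm, h⟩ := hper r
    exact ⟨m, n, hn, hnm, by simpa using congrArg π h⟩
  let Φ := MonoidAlgebra.mapRingHom G π
  obtain ⟨m, n, -, hnm, h⟩ := MonoidAlgebra.isPeriodicRing_of_comm hc hcQ hcomm hperQ hG (Φ x)
  refine exists_pow_eq_pow_of_isNilpotent_sub hc
    (by rw [MonoidAlgebra.natCast_def, hcR, MonoidAlgebra.single_zero]) hnm
    (MonoidAlgebra.isNilpotent_of_forall_isNilpotent_coeff h2p fun g => (hπ _).1 ?_)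
  rw [← MonoidAlgebra.coeff_mapRingHom, map_sub, map_pow, map_pow]
  simp [h, Φ]
end

section
/- Let R be a ring that is weakly 2-primal (the set Nil(R) of nilpotent elements of R is a two-sided ideal which is locally nilpotent, i.e., for every finite subset S of Nil(R) there exists a positive integer N such that every product of N elements of S equals 0) and periodic. Then for every positive integer n, the full matrix ring Mₙ(R) (Matrix (Fin n) (Fin n) R) is periodic. -/
open Polynomial

section PowEqSelf

variable {B : Type*} [Ring B]

/-- In a ring where every `x` satisfies some `x ^ (k + 2) = x`, the power `x ^ (k + 1)` is central. -/
theorem commute_pow_of_forall_pow_eq_self (h : ∀ x : B, ∃ k : ℕ, x ^ (k + 2) = x)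
    {x : B} {k : ℕ} (hx : x ^ (k + 2) = x) (b : B) : Commute (x ^ (k + 1)) b := by
  have sq_zero : ∀ y : B, y * y = 0 → y = 0 := by
    intro y hy
    obtain ⟨j, hj⟩ := h y
    rw [← hj, pow_add, pow_two, hy, mul_zero]
  have idem : x ^ (k + 1) * x ^ (k + 1) = x ^ (k + 1) := by
    rw [← pow_add, show k + 1 + (k + 1) = (k + 2) + k by ring, pow_add, hx, ← pow_succ']
  set f := x ^ (k + 1)
  have left : f * b - f * b * f = 0 := by
    apply sq_zero
    have : f * b * f * f = f * b * f := by rw [mul_assoc, idem]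
    have h2 : (f * b - f * b * f) * f = 0 := by rw [sub_mul, this, sub_self]
    calc (f * b - f * b * f) * (f * b - f * b * f)
        = ((f * b - f * b * f) * f) * (b - b * f) := by noncomm_ring
      _ = 0 := by rw [h2, zero_mul]
  have right : b * f - f * b * f = 0 := by
    apply sq_zero
    have h2 : f * (b * f - f * b * f) = 0 := by
      rw [mul_sub, ← mul_assoc, ← mul_assoc, ← mul_assoc, idem, sub_self]
    calc (b * f - f * b * f) * (b * f - f * b * f)
        = (b - f * b) * (f * (b * f - f * b * f)) := by noncomm_ring
      _ = 0 := by rw [h2, mul_zero]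
  exact (sub_eq_zero.mp left).trans (sub_eq_zero.mp right).symm

/-- In a ring where every `x` satisfies some `x ^ (k + 2) = x`, left ideals are two-sided. -/
theorem Ideal.isTwoSided_of_forall_pow_eq_self (h : ∀ x : B, ∃ k : ℕ, x ^ (k + 2) = x)
    (L : Ideal B) : L.IsTwoSided where
  mul_mem_of_left {x} b hx := by
    obtain ⟨k, hk⟩ := h x
    have : x * b = x * b * x ^ k * x := by
      have := commute_pow_of_forall_pow_eq_self h hk (x * b)
      rw [mul_assoc (x * b), ← pow_succ, ← this.eq, ← mul_assoc, ← pow_succ, hk]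
    rw [this]
    exact L.mul_mem_left _ hx

end PowEqSelf

/-- In a ring of positive characteristic, an element integral over `ℤ` generates a finite subring. -/
theorem IsIntegral.finite_adjoin_int {R : Type*} [Ring R] {k : ℕ} (hk : k ≠ 0) (hkR : (k : R) = 0)
    {x : R} (hx : IsIntegral ℤ x) : Finite (Algebra.adjoin ℤ {x}) := by
  have : Module.Finite ℤ (Algebra.adjoin ℤ {x}) :=
    Module.Finite.iff_fg.mpr hx.fg_adjoin_singleton
  refine Module.finite_of_fg_torsion _ fun y => ⟨⟨(k : ℤ), ?_⟩, ?_⟩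
  · simpa using hk
  · apply Subtype.ext
    simp [Submonoid.smul_def, hkR]

theorem isIntegral_int_of_pow_eq_pow {R : Type*} [Ring R] {x : R} {m n : ℕ} (hmn : n < m)
    (hx : x ^ m = x ^ n) : IsIntegral ℤ x := by
  refine ⟨X ^ m - X ^ n, monic_X_pow_sub (by simpa using hmn), ?_⟩
  simp [hx]

theorem exists_natCast_eq_zero_of_two_pow_eq_two_pow {R : Type*} [Ring R] {m n : ℕ} (hmn : n < m)
    (h : (2 : R) ^ m = 2 ^ n) : ∃ k : ℕ, k ≠ 0 ∧ (k : R) = 0 := by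
  have hlt : 2 ^ n < 2 ^ m := Nat.pow_lt_pow_right (by norm_num) hmn
  refine ⟨2 ^ m - 2 ^ n, by omega, ?_⟩
  rw [Nat.cast_sub hlt.le]
  simp [h]

theorem Module.End.exists_eigenvector_of_pow_card_eq_self {K V : Type*} [Field K] [Fintype K]
    [AddCommGroup V] [Module K V] (T : Module.End K V) (hT : T ^ Fintype.card K = T) (hT0 : T ≠ 0) :
    ∃ c : K, c ≠ 0 ∧ ∃ u : V, u ≠ 0 ∧ T u = c • u := by
  classical
  by_contra! hcon
  have hmonic : (X ^ Fintype.card K - X : K[X]).Monic :=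
    monic_X_pow_sub (by simpa using Fintype.one_lt_card)
  have hprod : ∏ c : K, (X - C c) = (X ^ Fintype.card K - X : K[X]) := by
    have := prod_multiset_X_sub_C_of_monic_of_roots_card_eq hmonic (by
      rw [FiniteField.roots_X_pow_card_sub_X,
        FiniteField.X_pow_card_sub_X_natDegree_eq K Fintype.one_lt_card]; rfl)
    rwa [FiniteField.roots_X_pow_card_sub_X] at this
  have hinj : ∀ s : Finset K, 0 ∉ s →
      Function.Injective (aeval T (∏ c ∈ s, (X - C c))) := by
    intro s
    induction s using Finset.induction_on with
    | empty => intro _; simpa using! Function.injective_id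
    | insert c s hc ih =>
      intro h0
      rw [Finset.prod_insert hc, map_mul, Module.End.mul_eq_comp, LinearMap.coe_comp]
      refine Function.Injective.comp ?_ (ih fun h => h0 (Finset.mem_insert_of_mem h))
      rw [injective_iff_map_eq_zero]
      intro u hu
      by_contra hu0
      refine hcon c (fun h => h0 (h ▸ Finset.mem_insert_self _ _)) u hu0 ?_
      simpa [sub_eq_zero, Module.algebraMap_end_apply] using hu
  apply hT0
  ext u
  apply hinj (Finset.univ.erase 0) (Finset.notMem_erase _ _)
  have hkill : aeval T (∏ c : K, (X - C c)) = 0 := by simp [hprod, hT]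
  rw [← Finset.prod_erase_mul _ _ (Finset.mem_univ (0 : K)), map_mul] at hkill
  simpa using LinearMap.congr_fun hkill u

/-- Jacobson's commutativity theorem for domains. -/
theorem Commute.of_isDomain_of_forall_pow_eq_self {D : Type*} [Ring D] [IsDomain D]
    (h : ∀ x : D, ∃ k : ℕ, x ^ (k + 2) = x) (a b : D) : Commute a b := by
  classical
  by_contra hab
  obtain ⟨N, hN0, hN⟩ : ∃ k : ℕ, k ≠ 0 ∧ (k : D) = 0 := by
    obtain ⟨k, hk⟩ := h 2
    exact exists_natCast_eq_zero_of_two_pow_eq_two_pow (n := 1) (by omega) (hk.trans (pow_one _).symm)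
  obtain ⟨p, hp⟩ := CharP.exists D
  have hp0 : p ≠ 0 := by
    rintro rfl
    have := CharP.charP_to_charZero D
    exact hN0 (Nat.cast_eq_zero.mp hN)
  have hpp : Fact p.Prime := ⟨(CharP.char_is_prime_or_zero D p).resolve_right hp0⟩
  let K := Algebra.adjoin ℤ {a}
  have : Finite K := by
    obtain ⟨k, hk⟩ := h a
    exact IsIntegral.finite_adjoin_int hN0 hN
      (isIntegral_int_of_pow_eq_pow (n := 1) (by omega) (hk.trans (pow_one _).symm))
  let _ : Fintype K := Fintype.ofFinite K
  let _ : Field K := (Finite.isDomain_to_isField K).toField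
  let a' : K := ⟨a, Algebra.self_mem_adjoin_singleton ℤ a⟩
  have hcomm : ∀ x y : K, (x : D) * y = y * x := fun x y => congrArg Subtype.val (mul_comm x y)
  let T : Module.End K D :=
    { toFun := fun x => a * x - x * a
      map_add' := fun x y => by noncomm_ring
      map_smul' := fun c x => by
        have : (c : D) * a = a * c := hcomm c a'
        simp only [RingHom.id_apply, Subalgebra.smul_def, smul_eq_mul]
        rw [mul_sub, ← mul_assoc, ← mul_assoc, ← mul_assoc, this] }
  have hT : T ^ Fintype.card K = T := by
    have : CharP K p := (RingHom.charP_iff K.toSubring.subtype Subtype.val_injective p).mpr hp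
    have : CharP (Module.End ℤ D) p := ⟨fun n => by
      rw [← CharP.cast_eq_zero_iff D p n]
      refine ⟨fun h => by simpa using LinearMap.congr_fun h (1 : D), fun h => ?_⟩
      ext x
      simp [h]⟩
    obtain ⟨r, -, hr⟩ := FiniteField.card K p
    have hpow : a ^ p ^ (r : ℕ) = a := by
      rw [← hr]
      exact congrArg Subtype.val (FiniteField.pow_card a')
    ext x
    have hS := LinearMap.congr_fun (sub_pow_char_pow_of_commute (p := p) (r : ℕ)
      (LinearMap.commute_mulLeft_right (R := ℤ) a a)) x
    rw [LinearMap.pow_mulLeft, LinearMap.pow_mulRight, hpow, Module.End.pow_apply] at hS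
    rw [hr, Module.End.pow_apply]
    exact hS
  have hT0 : T ≠ 0 := fun h0 => hab (sub_eq_zero.mp (LinearMap.congr_fun h0 b))
  obtain ⟨c, hc, u, hu, hTu⟩ := T.exists_eigenvector_of_pow_card_eq_self hT hT0
  replace hTu : a * u - u * a = c * u := hTu
  have hc : (c : D) ≠ 0 := fun h0 => hc (Subtype.ext h0)
  have hua : u * a = (a - c) * u := by rw [sub_mul, ← hTu]; abel
  have hconj : ∀ x ∈ K, ∃ y ∈ K, u * x = y * u := by
    intro x hx
    induction hx using Algebra.adjoin_induction with
    | mem x hx =>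
      rw [Set.mem_singleton_iff.mp hx]
      exact ⟨a - c, sub_mem a'.2 c.2, hua⟩
    | algebraMap n => exact ⟨n, intCast_mem K n, by simpa using (Int.cast_commute n u).eq.symm⟩
    | add x y _ _ hx hy =>
      obtain ⟨x', hx', hxe⟩ := hx
      obtain ⟨y', hy', hye⟩ := hy
      exact ⟨x' + y', add_mem hx' hy', by rw [mul_add, add_mul, hxe, hye]⟩
    | mul x y _ _ hx hy =>
      obtain ⟨x', hx', hxe⟩ := hx
      obtain ⟨y', hy', hye⟩ := hy
      exact ⟨x' * y', mul_mem hx' hy', by rw [← mul_assoc, hxe, mul_assoc, hye, mul_assoc]⟩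
  have hconj_pow : ∀ i : ℕ, ∃ y ∈ K, u ^ i * a = y * u ^ i := by
    intro i
    induction i with
    | zero => exact ⟨a, a'.2, by simp⟩
    | succ i ih =>
      obtain ⟨y, hy, hye⟩ := ih
      obtain ⟨z, hz, hze⟩ := hconj y hy
      exact ⟨z, hz, by rw [pow_succ', mul_assoc, hye, ← mul_assoc, hze, mul_assoc]⟩
  obtain ⟨k, hk⟩ := h u
  let V := Submodule.span K (Set.range fun i : Fin (k + 2) => u ^ (i : ℕ))
  have hV : ∀ i < k + 2, u ^ i ∈ V := fun i hi => Submodule.subset_span ⟨⟨i, hi⟩, rfl⟩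
  have : Module.Finite K V := Module.Finite.span_of_finite K (Set.finite_range _)
  have hVfin : Finite V := Module.finite_of_finite K
  have hVmul : ∀ y ∈ Algebra.adjoin ℤ {a, u}, ∀ v ∈ V, v * y ∈ V := by
    intro y hy
    induction hy using Algebra.adjoin_induction with
    | mem y hy =>
      intro v hv
      induction hv using Submodule.span_induction with
      | mem v hv =>
        obtain ⟨i, rfl⟩ := hv
        rcases hy with rfl | rfl
        · obtain ⟨z, hz, hze⟩ := hconj_pow i
          simp only [hze]
          exact V.smul_mem (⟨z, hz⟩ : K) (hV i i.2)
        · simp only [← pow_succ]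
          rcases Nat.lt_or_ge (i + 1) (k + 2) with hi | hi
          · exact hV _ hi
          · rw [show (i : ℕ) + 1 = k + 2 by omega, hk]
            simpa using hV 1 (by omega)
      | zero => simp
      | add v w _ _ hv hw => rw [add_mul]; exact add_mem hv hw
      | smul x v _ hv => rw [smul_mul_assoc]; exact V.smul_mem _ hv
    | algebraMap n =>
      intro v hv
      have : v * (algebraMap ℤ D n) = n • v := by
        rw [← Algebra.commutes, Algebra.smul_def]
      rw [this]
      exact zsmul_mem hv n
    | add x y _ _ hx hy =>
      intro v hv
      rw [mul_add]
      exact add_mem (hx v hv) (hy v hv)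
    | mul x y _ _ hx hy =>
      intro v hv
      rw [← mul_assoc]
      exact hy _ (hx v hv)
  have : Finite (Algebra.adjoin ℤ {a, u}) :=
    (Set.toFinite (V : Set D)).subset fun y hy => by
      simpa using hVmul y hy 1 (by simpa using hV 0 (by omega))
  have hau : a * u = u * a := congrArg Subtype.val
    ((Finite.isDomain_to_isField (Algebra.adjoin ℤ {a, u})).mul_comm
      ⟨a, Algebra.subset_adjoin (by simp)⟩ ⟨u, Algebra.subset_adjoin (by simp)⟩)
  rw [hau, sub_self] at hTu
  exact mul_ne_zero hc hu hTu.symm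

/-- **Jacobson's commutativity theorem**: a ring in which every `x` satisfies some
`x ^ (k + 2) = x` is commutative. -/
theorem Commute.of_forall_pow_eq_self {B : Type*} [Ring B]
    (h : ∀ x : B, ∃ k : ℕ, x ^ (k + 2) = x) (a b : B) : Commute a b := by
  obtain ⟨k, hk⟩ := h (a * b - b * a)
  set c := a * b - b * a with hc
  set e := c ^ (k + 1) with he
  have hce : c * e = c := by rw [he, ← pow_succ', hk]
  have hee : e * e = e := by
    calc e * e = c ^ k * (c * e) := by rw [← mul_assoc, ← pow_succ]
      _ = e := by rw [hce, ← pow_succ]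
  suffices Ideal.span {1 - e} = ⊤ by
    obtain ⟨r, hr⟩ := Ideal.mem_span_singleton'.mp (this ▸ Submodule.mem_top : (1 : B) ∈ _)
    have he0 : e = 0 := by
      rw [← one_mul e, ← hr, mul_assoc, sub_mul, one_mul, hee, sub_self, mul_zero]
    rw [he0, mul_zero] at hce
    exact sub_eq_zero.mp hce.symm
  by_contra hne
  obtain ⟨M, hM, hle⟩ := Ideal.exists_le_maximal _ hne
  have := M.isTwoSided_of_forall_pow_eq_self h
  have : Nontrivial (B ⧸ M) := Ideal.Quotient.nontrivial_iff.mpr hM.ne_top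
  have : NoZeroDivisors (B ⧸ M) := ⟨fun {x y} hxy => by
    obtain ⟨x, rfl⟩ := Ideal.Quotient.mk_surjective x
    obtain ⟨y, rfl⟩ := Ideal.Quotient.mk_surjective y
    rw [← map_mul, Ideal.Quotient.eq_zero_iff_mem] at hxy
    simp only [Ideal.Quotient.eq_zero_iff_mem]
    refine or_iff_not_imp_left.mpr fun hx => ?_
    obtain ⟨r, hr⟩ := Ideal.IsMaximal.exists_inv hM hx
    obtain ⟨m, hm, hrm⟩ := hr
    rw [← one_mul y, ← hrm, add_mul, mul_assoc]
    exact add_mem (M.mul_mem_left _ hxy) (M.mul_mem_right _ hm)⟩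
  have : IsDomain (B ⧸ M) := NoZeroDivisors.to_isDomain _
  have hcM : c ∈ M := by
    rw [← Ideal.Quotient.eq_zero_iff_mem, hc, map_sub, map_mul, map_mul, sub_eq_zero]
    refine Commute.of_isDomain_of_forall_pow_eq_self (fun x => ?_) _ _
    obtain ⟨x, rfl⟩ := Ideal.Quotient.mk_surjective x
    obtain ⟨j, hj⟩ := h x
    exact ⟨j, by rw [← map_pow, hj]⟩
  have heM : e ∈ M := by rw [he, pow_succ]; exact M.mul_mem_left _ hcM
  refine hM.ne_top (M.eq_top_iff_one.mpr ?_)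
  simpa using add_mem (hle (Ideal.mem_span_singleton_self _)) heM

/-- The entries of `D ^ k` lie in the additive subgroup generated by the products of `k` entries
of `D`. -/
theorem Matrix.pow_apply_mem_closure_prod {R ι : Type*} [Ring R] [Fintype ι] [DecidableEq ι]
    {D : Matrix ι ι R} {S : Set R} (hD : ∀ i j, D i j ∈ S) (k : ℕ) (i j : ι) :
    (D ^ k) i j ∈
      AddSubgroup.closure {x | ∃ l : List R, (∀ y ∈ l, y ∈ S) ∧ l.length = k ∧ l.prod = x} := by
  induction k generalizing i with
  | zero =>
    rw [pow_zero, Matrix.one_apply]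
    split_ifs
    · exact AddSubgroup.subset_closure ⟨[], by simp⟩
    · exact zero_mem _
  | succ k ih =>
    rw [pow_succ', Matrix.mul_apply]
    refine sum_mem fun r _ => ?_
    have hr := ih r
    generalize (D ^ k) r j = z at hr
    induction hr using AddSubgroup.closure_induction with
    | mem x hx =>
      obtain ⟨l, hl, hlen, rfl⟩ := hx
      exact AddSubgroup.subset_closure ⟨D i r :: l, by simpa using ⟨hD i r, hl⟩, by simpa, by simp⟩
    | zero => simp
    | add x y _ _ hx hy => rw [mul_add]; exact add_mem hx hy
    | neg x _ hx => rw [mul_neg]; exact neg_mem hx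

theorem IsWeakly2Primal.isNilpotent_matrix {R ι : Type*} [Ring R] [Fintype ι] [DecidableEq ι]
    (h : IsWeakly2Primal R) {D : Matrix ι ι R} (hD : ∀ i j, IsNilpotent (D i j)) :
    IsNilpotent D := by
  classical
  let S : Finset R := Finset.univ.image fun ij : ι × ι => D ij.1 ij.2
  obtain ⟨N, -, hN⟩ := h.2 S (by simpa [S, forall_comm (α := R)] using hD)
  refine ⟨N, ?_⟩
  ext i j
  have hmem := Matrix.pow_apply_mem_closure_prod (S := S) (D := D)
    (fun i j => Finset.mem_coe.mpr (Finset.mem_image_of_mem _ (Finset.mem_univ (i, j)))) N i j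
  refine AddSubgroup.mem_bot.mp ((AddSubgroup.closure_le _).mpr ?_ hmem)
  rintro _ ⟨l, hl, hlen, rfl⟩
  exact hN l hl hlen

theorem IsReduced.pow_succ_eq_self {B : Type*} [Ring B] [IsReduced B] {x : B} {m n : ℕ}
    (hnm : n ≤ m) (h : x ^ m = x ^ n) : x ^ (m - n + 1) = x := by
  have hcomm : Commute x (x ^ (m - n) - 1) := ((Commute.refl x).pow_right _).sub_right (.one_right x)
  have hzero : x ^ n * (x ^ (m - n) - 1) = 0 := by
    rw [mul_sub, ← pow_add, Nat.add_sub_cancel' hnm, mul_one, h, sub_self]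
  have hnil : IsNilpotent (x * (x ^ (m - n) - 1)) := by
    refine ⟨n + 1, ?_⟩
    rw [hcomm.mul_pow, pow_succ' (x ^ (m - n) - 1), pow_succ', mul_assoc, ← mul_assoc (x ^ n),
      hzero, zero_mul, mul_zero]
  rw [pow_succ', ← sub_eq_zero]
  simpa [mul_sub] using hnil.eq_zero

theorem isIntegral_int_matrix_of_forall_pow_eq_self {B ι : Type*} [Ring B] [Fintype ι]
    [DecidableEq ι] (h : ∀ x : B, ∃ k : ℕ, x ^ (k + 2) = x) (A : Matrix ι ι B) :
    IsIntegral ℤ A := by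
  let _ : CommRing B :=
    { ‹Ring B› with mul_comm := fun a b => (Commute.of_forall_pow_eq_self h a b).eq }
  have : Algebra.IsIntegral ℤ B := ⟨fun x => by
    obtain ⟨k, hk⟩ := h x
    exact isIntegral_int_of_pow_eq_pow (n := 1) (by omega) (hk.trans (pow_one _).symm)⟩
  exact isIntegral_trans A (Matrix.isIntegral A)

theorem IsWeakly2Primal.isIntegral_int_matrix {R ι : Type*} [Ring R] [Fintype ι] [DecidableEq ι]
    (h2p : IsWeakly2Primal R) (hper : IsPeriodicRing R) (A : Matrix ι ι R) : IsIntegral ℤ A := by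
  obtain ⟨I, hI⟩ := h2p.1
  let J := I.asIdeal
  have hJ : ∀ x : R, Ideal.Quotient.mk J x = 0 ↔ IsNilpotent x := fun x => by
    rw [Ideal.Quotient.eq_zero_iff_mem, TwoSidedIdeal.mem_asIdeal, hI]
  have : IsReduced (R ⧸ J) := ⟨fun x hx => by
    obtain ⟨x, rfl⟩ := Ideal.Quotient.mk_surjective x
    obtain ⟨k, hk⟩ := hx
    rw [← map_pow, hJ] at hk
    obtain ⟨l, hl⟩ := hk
    exact (hJ x).mpr ⟨k * l, by rw [pow_mul, hl]⟩⟩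
  have hpow : ∀ x : R ⧸ J, ∃ k : ℕ, x ^ (k + 2) = x := by
    intro x
    obtain ⟨x, rfl⟩ := Ideal.Quotient.mk_surjective x
    obtain ⟨m, n, -, hnm, hx⟩ := hper x
    refine ⟨m - n - 1, ?_⟩
    rw [show m - n - 1 + 2 = m - n + 1 by omega]
    exact IsReduced.pow_succ_eq_self hnm.le (by rw [← map_pow, hx, map_pow])
  let φ : Matrix ι ι R →+* Matrix ι ι (R ⧸ J) := (Ideal.Quotient.mk J).mapMatrix
  obtain ⟨f, hf, hfA⟩ := isIntegral_int_matrix_of_forall_pow_eq_self hpow (φ A)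
  have hzero : φ (aeval A f) = 0 := by
    rw [← hfA, aeval_def, hom_eval₂]
    congr 1
    exact RingHom.ext_int _ _
  obtain ⟨N, hN⟩ := h2p.isNilpotent_matrix (D := aeval A f) fun i j =>
    (hJ _).mp (congrFun (congrFun hzero i) j)
  exact ⟨f ^ N, hf.pow N, by rw [← aeval_def, map_pow, hN]⟩

/-- If `R` is a weakly 2-primal periodic ring, then the full matrix ring `Mₙ(R)`
is periodic for all `n ≥ 1`. -/
theorem periodic_matrix_of_weakly2Primal (R : Type*) [Ring R]
    (h2p : IsWeakly2Primal R) (hper : IsPeriodicRing R) (n : ℕ) (hn : 0 < n) :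
    IsPeriodicRing (Matrix (Fin n) (Fin n) R) := by
  intro A
  obtain ⟨m, l, -, hlm, h2⟩ := hper 2
  obtain ⟨k, hk, hkR⟩ := exists_natCast_eq_zero_of_two_pow_eq_two_pow hlm h2
  have : Finite (Algebra.adjoin ℤ {A}) :=
    IsIntegral.finite_adjoin_int hk (by rw [← map_natCast (Matrix.scalar (Fin n)), hkR, map_zero])
      (h2p.isIntegral_int_matrix hper A)
  let A' : Algebra.adjoin ℤ {A} := ⟨A, Algebra.self_mem_adjoin_singleton ℤ A⟩
  obtain ⟨i, j, hij, heq⟩ :=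
    Finite.exists_ne_map_eq_of_infinite fun i : ℕ => A' ^ (i + 1)
  replace heq : A ^ (i + 1) = A ^ (j + 1) := congrArg Subtype.val heq
  rcases hij.lt_or_gt with hlt | hlt
  · exact ⟨j + 1, i + 1, by omega, by omega, heq.symm⟩
  · exact ⟨i + 1, j + 1, by omega, by omega, heq⟩
end

section
/- If R is a (left) Artinian periodic ring, then for every positive integer n the full matrix ring Mₙ(R) (Matrix (Fin n) (Fin n) R) is periodic. -/
open Polynomial

namespace IsPeriodicRing

theorem of_surjective {R S : Type*} [Ring R] [Ring S] (hR : IsPeriodicRing R) (f : R →+* S)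
    (hf : Function.Surjective f) : IsPeriodicRing S := by
  intro y
  obtain ⟨x, rfl⟩ := hf y
  obtain ⟨m, n, hn, hnm, h⟩ := hR x
  exact ⟨m, n, hn, hnm, by rw [← map_pow, ← map_pow, h]⟩

theorem of_injective {R S : Type*} [Ring R] [Ring S] (hS : IsPeriodicRing S) (f : R →+* S)
    (hf : Function.Injective f) : IsPeriodicRing R := by
  intro x
  obtain ⟨m, n, hn, hnm, h⟩ := hS (f x)
  exact ⟨m, n, hn, hnm, hf (by rw [map_pow, map_pow, h])⟩

theorem isIntegral {R : Type*} [Ring R] (hR : IsPeriodicRing R) (x : R) : IsIntegral ℤ x := by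
  obtain ⟨m, n, -, hnm, h⟩ := hR x
  refine ⟨X ^ m - X ^ n, monic_X_pow_sub (by simpa using hnm), ?_⟩
  simp [h]

theorem exists_natCast_eq_zero_s7 {R : Type*} [Ring R] (hR : IsPeriodicRing R) :
    ∃ N : ℕ, 0 < N ∧ (N : R) = 0 := by
  obtain ⟨m, n, -, hnm, h⟩ := hR 2
  have hlt : 2 ^ n < 2 ^ m := Nat.pow_lt_pow_right (by norm_num) hnm
  refine ⟨2 ^ m - 2 ^ n, Nat.sub_pos_of_lt hlt, ?_⟩
  rw [Nat.cast_sub hlt.le]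
  simp [h]

theorem isOfFinOrder {D : Type*} [DivisionRing D] (hD : IsPeriodicRing D) {x : D} (hx : x ≠ 0) :
    IsOfFinOrder x := by
  obtain ⟨m, n, -, hnm, h⟩ := hD x
  refine isOfFinOrder_iff_pow_eq_one.2 ⟨m - n, Nat.sub_pos_of_lt hnm, ?_⟩
  rw [pow_sub₀ x hx hnm.le, h, mul_inv_cancel₀ (pow_ne_zero n hx)]

end IsPeriodicRing

/-- In a ring of positive characteristic, an integral element has only finitely many powers. -/
theorem IsIntegral.exists_pow_eq_pow {S : Type*} [Ring S] {N : ℕ} (hN : 0 < N)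
    (hS : (N : S) = 0) {x : S} (hx : IsIntegral ℤ x) :
    ∃ m n : ℕ, 0 < n ∧ n < m ∧ x ^ m = x ^ n := by
  have : NeZero N := ⟨hN.ne'⟩
  obtain ⟨r, hr⟩ := CharP.exists S
  have hrN : r ∣ N := (CharP.cast_eq_zero_iff S r N).1 hS
  let : Algebra (ZMod N) S := ZMod.algebra' S r hrN
  have hx' : IsIntegral (ZMod N) x := hx.tower_top
  have : Module.Finite (ZMod N) (Algebra.adjoin (ZMod N) {x}) :=
    Module.Finite.iff_fg.2 hx'.fg_adjoin_singleton
  have : Finite (Algebra.adjoin (ZMod N) {x}) := Module.finite_of_finite (ZMod N)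
  obtain ⟨i, j, hij, h⟩ := Finite.exists_ne_map_eq_of_infinite
    fun k : ℕ ↦ (⟨x, Algebra.self_mem_adjoin_singleton _ x⟩ : Algebra.adjoin (ZMod N) {x}) ^ (k + 1)
  have h' : x ^ (i + 1) = x ^ (j + 1) := by simpa using congrArg Subtype.val h
  rcases hij.lt_or_gt with hlt | hlt
  · exact ⟨j + 1, i + 1, by omega, by omega, h'.symm⟩
  · exact ⟨i + 1, j + 1, by omega, by omega, h'⟩

/-- Integrality can be tested along finitely many ring homomorphisms whose common kernel is nil. -/
theorem isIntegral_of_forall_map {ι S : Type*} [Fintype ι] [Ring S] {T : ι → Type*}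
    [∀ i, Ring (T i)] (f : ∀ i, S →+* T i) (hf : ∀ z, (∀ i, f i z = 0) → IsNilpotent z) {x : S}
    (hx : ∀ i, IsIntegral ℤ (f i x)) : IsIntegral ℤ x := by
  choose p hp hpx using hx
  obtain ⟨k, hk⟩ := hf (aeval x (∏ i, p i)) fun i ↦ by
    rw [← RingHom.toIntAlgHom_apply (f i), ← aeval_algHom_apply]
    obtain ⟨q, hq⟩ := Finset.dvd_prod_of_mem p (Finset.mem_univ i)
    have : aeval ((f i).toIntAlgHom x) (p i) = 0 := hpx i
    rw [hq, map_mul, this, zero_mul]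
  refine ⟨(∏ i, p i) ^ k, (monic_prod_of_monic _ _ fun i _ ↦ hp i).pow k, ?_⟩
  rw [← aeval_def, map_pow, hk]

theorem Matrix.isNilpotent_of_forall_mem {R n : Type*} [Ring R] [Fintype n] [DecidableEq n]
    {I : Ideal R} (hI : IsNilpotent I) {A : Matrix n n R} (hA : ∀ i j, A i j ∈ I) :
    IsNilpotent A := by
  obtain ⟨k, hk⟩ := hI
  have key : ∀ m i j, (A ^ m) i j ∈ I ^ m := by
    intro m
    induction m with
    | zero => simp [Submodule.pow_zero, Ideal.one_eq_top]
    | succ m ih =>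
      intro i j
      rw [pow_succ, Submodule.pow_succ, Matrix.mul_apply]
      exact Ideal.sum_mem _ fun l _ ↦ Ideal.mul_mem_mul (ih i l) (hA l j)
  refine ⟨k, ?_⟩
  ext i j
  simpa [hk] using key k i j

/-- Over a finite ring, a set generating a finite submonoid generates a finite subalgebra. -/
theorem Algebra.finite_adjoin_of_finite_closure (k : Type*) {A : Type*} [CommRing k] [Finite k]
    [Ring A] [Algebra k A] {s : Set A} (hs : (Submonoid.closure s : Set A).Finite) :
    Finite (Algebra.adjoin k s) := by
  have : Module.Finite k (Algebra.adjoin k s) := by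
    refine Module.Finite.iff_fg (N := Subalgebra.toSubmodule (Algebra.adjoin k s)).2 ?_
    rw [Algebra.adjoin_eq_span]
    exact Submodule.fg_span hs
  exact Module.finite_of_finite k

/-- An endomorphism satisfying `δ ^ q = δ` over the field with `q` elements is zero or has a
nonzero eigenvalue. -/
theorem Module.End.exists_eigenvector_of_pow_card_eq {K V : Type*} [Field K] [Fintype K]
    [AddCommGroup V] [Module K V] {δ : Module.End K V} (hδ : δ ≠ 0)
    (hpow : δ ^ Fintype.card K = δ) : ∃ c : K, c ≠ 0 ∧ ∃ v : V, v ≠ 0 ∧ δ v = c • v := by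
  classical
  by_contra! hno
  have hinj : ∀ s : Finset K, (∀ c ∈ s, c ≠ 0) →
      Function.Injective (aeval δ (∏ c ∈ s, (X - C c))) := by
    intro s
    induction s using Finset.induction_on with
    | empty => intro _; exact fun v w h ↦ by simpa using h
    | insert c s hc ih =>
      intro hs
      rw [Finset.prod_insert hc, map_mul, Module.End.coe_mul]
      refine Function.Injective.comp ?_ (ih fun d hd ↦ hs d (Finset.mem_insert_of_mem hd))
      refine (injective_iff_map_eq_zero _).2 fun v hv ↦ ?_
      by_contra hv0
      refine hno c (hs c (Finset.mem_insert_self c s)) v hv0 ?_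
      simpa [sub_eq_zero] using hv
  have hprod : (∏ c ∈ Finset.univ.erase (0 : K), (X - C c)) * X = X ^ Fintype.card K - X := by
    have hmonic : (X ^ Fintype.card K - X : K[X]).Monic :=
      monic_X_pow_sub (by simpa using Fintype.one_lt_card)
    have h := prod_multiset_X_sub_C_of_monic_of_roots_card_eq hmonic (by
      rw [FiniteField.roots_X_pow_card_sub_X,
        FiniteField.X_pow_card_sub_X_natDegree_eq K Fintype.one_lt_card]
      rfl)
    rw [FiniteField.roots_X_pow_card_sub_X] at h
    rw [← h]
    change _ = ∏ c : K, (X - C c)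
    rw [← Finset.prod_erase_mul _ _ (Finset.mem_univ (0 : K))]
    simp
  apply hδ
  ext v
  refine hinj (Finset.univ.erase 0) (fun c hc ↦ Finset.ne_of_mem_erase hc) ?_
  have := congrArg (fun P ↦ aeval δ P v) hprod
  simpa [hpow] using this

/-- If `a` generates a finite subfield of a division ring and is not central, then some nonzero
element conjugates `a` to a different element of that subfield. -/
theorem exists_conj_mem_adjoin_of_finite {D : Type*} [DivisionRing D] (p : ℕ) [Fact p.Prime]
    [Algebra (ZMod p) D] {a x : D} [Finite (Algebra.adjoin (ZMod p) {a})] (hx : x * a ≠ a * x) :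
    ∃ b : D, b ≠ 0 ∧ b * a ≠ a * b ∧ ∃ a' ∈ Algebra.adjoin (ZMod p) {a}, b * a = a' * b := by
  classical
  let K := Algebra.adjoin (ZMod p) {a}
  have : Fintype K := Fintype.ofFinite K
  let : DivisionRing K := Fintype.divisionRingOfIsDomain K
  let : Field K := littleWedderburn K
  have : CharP K p := charP_of_injective_algebraMap (algebraMap (ZMod p) K).injective p
  have : CharP (Module.End K D) p :=
    charP_of_injective_algebraMap (algebraMap K (Module.End K D)).injective p
  let α : K := ⟨a, Algebra.self_mem_adjoin_singleton _ a⟩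
  let δ : Module.End K D := LinearMap.mulRight K a - algebraMap K (Module.End K D) α
  have hδ_apply : ∀ y, δ y = y * a - a * y := fun y ↦ rfl
  have hright : ∀ n : ℕ, ∀ y, (LinearMap.mulRight K a ^ n : Module.End K D) y = y * a ^ n := by
    intro n
    induction n with
    | zero => simp
    | succ n ih =>
      intro y
      rw [pow_succ', Module.End.mul_apply, ih, LinearMap.mulRight_apply, pow_succ, mul_assoc]
  have hα : α ^ Fintype.card K = α := FiniteField.pow_card α
  have ha : a ^ Fintype.card K = a := by simpa using congrArg Subtype.val hα
  have hpow : δ ^ Fintype.card K = δ := by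
    obtain ⟨n, -, hn⟩ := FiniteField.card K p
    have hsub : δ ^ Fintype.card K = (LinearMap.mulRight K a : Module.End K D) ^ Fintype.card K -
        algebraMap K (Module.End K D) α ^ Fintype.card K := by
      rw [hn]
      exact sub_pow_char_pow_of_commute p n (Algebra.commutes α _).symm
    rw [hsub, ← map_pow, hα]
    congr 1
    ext y
    rw [hright, ha, LinearMap.mulRight_apply]
  have hδ : δ ≠ 0 := fun h ↦ hx (sub_eq_zero.1 ((hδ_apply x).symm.trans (by simp [h])))
  obtain ⟨c, hc, b, hb, hcb⟩ := Module.End.exists_eigenvector_of_pow_card_eq hδ hpow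
  have hcb' : b * a - a * b = c * b := hcb
  have hc' : (c : D) ≠ 0 := fun h ↦ hc (Subtype.ext h)
  refine ⟨b, hb, fun h ↦ ?_, a + c, add_mem (Algebra.self_mem_adjoin_singleton _ a) c.2, ?_⟩
  · rw [h, sub_self] at hcb'
    exact mul_ne_zero hc' hb hcb'.symm
  · rw [add_mul, ← hcb']
    abel

/-- In a division ring, if `b` has finitely many powers and conjugates `a` into the finite subfield
generated by `a`, then it commutes with `a`. -/
theorem mul_comm_of_conj_mem_adjoin {D : Type*} [DivisionRing D] (p : ℕ) [Fact p.Prime]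
    [Algebra (ZMod p) D] {a b a' : D} [Finite (Algebra.adjoin (ZMod p) {a})]
    (hb : (Submonoid.powers b : Set D).Finite) (ha' : a' ∈ Algebra.adjoin (ZMod p) {a})
    (hconj : b * a = a' * b) : b * a = a * b := by
  let K := Algebra.adjoin (ZMod p) {a}
  have hb_swap : ∀ k ∈ K, ∃ k' ∈ K, b * k = k' * b := by
    intro k hk
    induction hk using Algebra.adjoin_induction with
    | mem y hy =>
      obtain rfl := Set.mem_singleton_iff.1 hy
      exact ⟨a', ha', hconj⟩
    | algebraMap r => exact ⟨_, K.algebraMap_mem r, (Algebra.commutes r b).symm⟩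
    | add y z _ _ hy hz =>
      obtain ⟨y', hy', hy⟩ := hy
      obtain ⟨z', hz', hz⟩ := hz
      exact ⟨y' + z', add_mem hy' hz', by rw [mul_add, add_mul, hy, hz]⟩
    | mul y z _ _ hy hz =>
      obtain ⟨y', hy', hy⟩ := hy
      obtain ⟨z', hz', hz⟩ := hz
      exact ⟨y' * z', mul_mem hy' hz', by rw [← mul_assoc, hy, mul_assoc, hz, mul_assoc]⟩
  have hpow_swap : ∀ j : ℕ, ∀ k ∈ K, ∃ k' ∈ K, b ^ j * k = k' * b ^ j := by
    intro j
    induction j with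
    | zero => exact fun k hk ↦ ⟨k, hk, by simp⟩
    | succ j ih =>
      intro k hk
      obtain ⟨k₁, hk₁, h₁⟩ := hb_swap k hk
      obtain ⟨k₂, hk₂, h₂⟩ := ih k₁ hk₁
      exact ⟨k₂, hk₂, by rw [pow_succ, mul_assoc, h₁, ← mul_assoc, h₂, mul_assoc]⟩
  let M : Submonoid D :=
    { carrier := Set.image2 (· * ·) (K : Set D) (Submonoid.powers b : Set D)
      one_mem' := ⟨1, K.one_mem, 1, one_mem _, by simp⟩
      mul_mem' := by
        rintro _ _ ⟨k, hk, _, ⟨i, rfl⟩, rfl⟩ ⟨l, hl, _, ⟨j, rfl⟩, rfl⟩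
        obtain ⟨l', hl', h⟩ := hpow_swap i l hl
        refine ⟨k * l', K.mul_mem hk hl', b ^ (i + j), ⟨i + j, rfl⟩, ?_⟩
        simp only [pow_add, mul_assoc]
        rw [← mul_assoc (b ^ i) l, h, mul_assoc] }
  have hM : (M : Set D).Finite := Set.Finite.image2 _ (Set.toFinite (K : Set D)) (hb)
  have : Finite (Algebra.adjoin (ZMod p) (M : Set D)) :=
    Algebra.finite_adjoin_of_finite_closure (ZMod p) (by rwa [Submonoid.closure_eq])
  have haM : a ∈ Algebra.adjoin (ZMod p) (M : Set D) := Algebra.subset_adjoin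
    ⟨a, Algebra.self_mem_adjoin_singleton _ a, 1, one_mem _, by simp⟩
  have hbM : b ∈ Algebra.adjoin (ZMod p) (M : Set D) := Algebra.subset_adjoin
    ⟨1, K.one_mem, b, Submonoid.mem_powers b, by simp⟩
  exact congrArg Subtype.val ((Finite.isDomain_to_isField
    (Algebra.adjoin (ZMod p) (M : Set D))).mul_comm ⟨b, hbM⟩ ⟨a, haM⟩)

/-- **Jacobson's theorem** for division rings: a periodic division ring is commutative. -/
theorem IsPeriodicRing.mul_comm {D : Type*} [DivisionRing D] (hD : IsPeriodicRing D) (x a : D) :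
    x * a = a * x := by
  by_contra hx
  obtain ⟨p, hp⟩ := CharP.exists D
  obtain ⟨N, hN, hN0⟩ := hD.exists_natCast_eq_zero_s7
  have hp0 : p ≠ 0 := by
    rintro rfl
    exact hN.ne' (Nat.eq_zero_of_zero_dvd ((CharP.cast_eq_zero_iff D 0 N).1 hN0))
  have : Fact p.Prime := ⟨(CharP.char_is_prime_or_zero D p).resolve_right hp0⟩
  let : Algebra (ZMod p) D := ZMod.algebra D p
  have hfin : ∀ y : D, y ≠ 0 → (Submonoid.powers y : Set D).Finite := fun y hy ↦
    (hD.isOfFinOrder hy).finite_powers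
  have ha : a ≠ 0 := by
    rintro rfl
    simp at hx
  have : Finite (Algebra.adjoin (ZMod p) {a}) :=
    Algebra.finite_adjoin_of_finite_closure (ZMod p)
      (by rw [← Submonoid.powers_eq_closure]; exact hfin a ha)
  obtain ⟨b, hb, hba, a', ha', hconj⟩ := exists_conj_mem_adjoin_of_finite p hx
  exact hba (mul_comm_of_conj_mem_adjoin p (hfin b hb) ha' hconj)

/-- Matrices over a periodic division ring are integral over `ℤ`. -/
theorem IsPeriodicRing.isIntegral_matrix {D n : Type*} [DivisionRing D] [Fintype n]
    [DecidableEq n] (hD : IsPeriodicRing D) (A : Matrix n n D) : IsIntegral ℤ A := by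
  let : Field D := { ‹DivisionRing D› with mul_comm := hD.mul_comm }
  have : Algebra.IsIntegral ℤ D := ⟨hD.isIntegral⟩
  exact isIntegral_trans A (Matrix.isIntegral A)

/-- If `R` is an Artinian periodic ring, then the matrix ring `Mₙ(R)` is periodic
for any `n ≥ 1`. -/
theorem periodic_matrix_of_artinian (R : Type*) [Ring R] [IsArtinianRing R]
    (hper : IsPeriodicRing R) (n : ℕ) (hn : 0 < n) :
    IsPeriodicRing (Matrix (Fin n) (Fin n) R) := by
  obtain ⟨N, hN, hN0⟩ := hper.exists_natCast_eq_zero_s7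
  have hNM : (N : Matrix (Fin n) (Fin n) R) = 0 := by
    rw [← map_natCast (Matrix.scalar (Fin n) : R →+* _), hN0, map_zero]
  obtain ⟨r, D, d, _, _, ⟨e⟩⟩ :=
    IsSemisimpleRing.exists_ringEquiv_pi_matrix_divisionRing (R ⧸ Ring.jacobson R)
  let g (i : Fin r) : R →+* Matrix (Fin (d i)) (Fin (d i)) (D i) :=
    (Pi.evalRingHom _ i).comp (e.toRingHom.comp (Ideal.Quotient.mk (Ring.jacobson R)))
  have hg (i : Fin r) : Function.Surjective (g i) :=
    (Function.surjective_eval i).comp (e.surjective.comp Ideal.Quotient.mk_surjective)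
  have hD (i : Fin r) : IsPeriodicRing (D i) :=
    (hper.of_surjective (g i) (hg i)).of_injective (Matrix.scalar (Fin (d i)))
      fun _ _ h ↦ Matrix.scalar_inj.1 h
  intro A
  refine IsIntegral.exists_pow_eq_pow hN hNM
    (isIntegral_of_forall_map
      (fun i ↦ (Matrix.compRingEquiv (Fin n) (Fin (d i)) (D i)).toRingHom.comp (g i).mapMatrix)
      (fun B hB ↦ ?_) fun i ↦ (hD i).isIntegral_matrix _)
  refine Matrix.isNilpotent_of_forall_mem (IsSemiprimaryRing.isNilpotent (R := R)) fun k l ↦ ?_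
  rw [← Ideal.Quotient.eq_zero_iff_mem, ← map_eq_zero_iff e e.injective]
  ext1 i
  have hBi : (g i).mapMatrix B = 0 :=
    (Matrix.compRingEquiv (Fin n) (Fin (d i)) (D i)).map_eq_zero_iff.1 (hB i)
  exact congrFun (congrFun hBi k) l
end

section
/- If R is a potent ring, then for every positive integer n, every matrix A ∈ Mₙ(R) (Matrix (Fin n) (Fin n) R) can be written as A = T + P where T is a tripotent matrix (T^3 = T) and P is a potent matrix (P^m = P for some integer m ≥ 2). -/
/-- A ring `R` is *potent* if for every `x ∈ R` there is an integer `m ≥ 2`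
with `x ^ m = x`. -/
def IsPotentRing (R : Type*) [Ring R] : Prop :=
  ∀ x : R, ∃ m : ℕ, 2 ≤ m ∧ x ^ m = x

open Polynomial

namespace IsPotentRing

variable {R : Type*} [Ring R]

theorem exists_pow_add_two_eq (hR : IsPotentRing R) (x : R) : ∃ k : ℕ, x ^ (k + 2) = x := by
  obtain ⟨m, hm, h⟩ := hR x
  exact ⟨m - 2, by rwa [Nat.sub_add_cancel hm]⟩

theorem of_injective {S : Type*} [Ring S] (hR : IsPotentRing R) (f : S →+* R)
    (hf : Function.Injective f) : IsPotentRing S := fun x ↦ by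
  obtain ⟨m, hm, h⟩ := hR (f x)
  exact ⟨m, hm, hf (by rw [map_pow, h])⟩

theorem of_surjective {S : Type*} [Ring S] (hR : IsPotentRing R) (f : R →+* S)
    (hf : Function.Surjective f) : IsPotentRing S := fun y ↦ by
  obtain ⟨x, rfl⟩ := hf y
  obtain ⟨m, hm, h⟩ := hR x
  exact ⟨m, hm, by rw [← map_pow, h]⟩

theorem isReduced (hR : IsPotentRing R) : IsReduced R where
  eq_zero x := by
    rintro ⟨n, hn⟩
    obtain ⟨k, hk⟩ := hR.exists_pow_add_two_eq x
    have h : ∀ j : ℕ, x = x ^ (j * (k + 1) + 1) := fun j ↦ by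
      induction j with
      | zero => simp
      | succ j ih =>
        calc x = x ^ (k + 2) := hk.symm
          _ = x ^ (k + 1) * x := pow_succ _ _
          _ = x ^ (k + 1) * x ^ (j * (k + 1) + 1) := by rw [← ih]
          _ = _ := by rw [← pow_add]; congr 1; ring
    rw [h n]
    exact pow_eq_zero_of_le (by nlinarith) hn

theorem exists_charP (hR : IsPotentRing R) : ∃ c : ℕ, c ≠ 0 ∧ CharP R c := by
  obtain ⟨c, hc⟩ := CharP.exists R
  refine ⟨c, ?_, hc⟩
  rintro rfl
  obtain ⟨k, hk⟩ := hR.exists_pow_add_two_eq 2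
  have h : ((2 ^ (k + 2) : ℕ) : R) = ((2 : ℕ) : R) := by push_cast; exact hk
  have := CharP.charP_to_charZero R
  have h2 := Nat.cast_injective h
  have : 2 ^ (k + 2) = 2 ^ k * 4 := by ring
  have : 0 < 2 ^ k := by positivity
  omega

theorem isOfFinOrder {D : Type*} [DivisionRing D] (hD : IsPotentRing D) {x : D} (hx : x ≠ 0) :
    IsOfFinOrder x := by
  obtain ⟨k, hk⟩ := hD.exists_pow_add_two_eq x
  refine isOfFinOrder_iff_pow_eq_one.2 ⟨k + 1, k.succ_pos, ?_⟩
  exact mul_right_cancel₀ hx (by rw [← pow_succ, hk, one_mul])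

end IsPotentRing

/-- If a product of linear factors of an endomorphism kills a nonzero vector, then one of the
factors has a nonzero kernel. -/
theorem Module.End.exists_apply_eq_smul_of_aeval_prod_X_sub_C {K V : Type*} [CommRing K]
    [AddCommGroup V] [Module K V] (f : Module.End K V) (s : Finset K) :
    ∀ w : V, w ≠ 0 → aeval f (∏ c ∈ s, (X - C c)) w = 0 →
      ∃ c ∈ s, ∃ y : V, y ≠ 0 ∧ f y = c • y := by
  classical
  induction s using Finset.induction_on with
  | empty => intro w hw h; simp_all
  | insert c s hc ih =>
    intro w hw h
    by_cases h0 : f w = c • w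
    · exact ⟨c, Finset.mem_insert_self _ _, w, hw, h0⟩
    · rw [Finset.prod_insert hc, mul_comm, map_mul, Module.End.mul_apply] at h
      obtain ⟨d, hd, y, hy⟩ := ih _ (by simpa [sub_eq_zero] using h0) h
      exact ⟨d, Finset.mem_insert_of_mem hd, y, hy⟩

open scoped IsMulCommutative in
theorem exists_mul_eq_pow_mul_of_not_commute {D : Type*} [DivisionRing D] {a v : D}
    (ha : IsOfFinOrder a) (hv : ¬ Commute v a) :
    ∃ y : D, y ≠ 0 ∧ ∃ k : ℕ, a ^ k ≠ a ∧ y * a = a ^ k * y := by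
  classical
  let K := Subring.closure ({a} : Set D)
  have : IsMulCommutative K := Subring.isMulCommutative_closure (by simp)
  let b : K := ⟨a, Subring.subset_closure rfl⟩
  let f : Module.End K D :=
    { toFun y := y * a
      map_add' x y := add_mul x y a
      map_smul' c y := mul_assoc (c : D) y a }
  have hfpow : ∀ (n : ℕ) (y : D), (f ^ n) y = y * a ^ n := fun n ↦ by
    induction n with
    | zero => simp
    | succ n ih =>
      intro y
      rw [pow_succ, Module.End.mul_apply, ih, pow_succ', ← mul_assoc]
      rfl
  have hN : 0 < orderOf a := ha.orderOf_pos
  have hb : IsPrimitiveRoot b (orderOf a) :=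
    orderOf_injective K.subtype.toMonoidHom K.subtype_injective b ▸ IsPrimitiveRoot.orderOf b
  have hbmem : b ∈ nthRootsFinset (orderOf a) (1 : K) :=
    (mem_nthRootsFinset hN 1).2 hb.pow_eq_one
  have hzero : aeval f (X ^ orderOf a - 1 : K[X]) = 0 := by
    ext y
    simp [hfpow, pow_orderOf_eq_one]
  rw [X_pow_sub_one_eq_prod hN hb, ← Finset.prod_erase_mul _ _ hbmem, map_mul] at hzero
  have hw : aeval f (X - C b) v ≠ 0 := by
    have hv' : f v ≠ b • v := hv
    simpa [sub_eq_zero] using hv'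
  obtain ⟨c, hc, y, hy, hyc⟩ := f.exists_apply_eq_smul_of_aeval_prod_X_sub_C _ _ hw
    (DFunLike.congr_fun hzero v)
  obtain ⟨hcb, hc⟩ := Finset.mem_erase.1 hc
  have : NeZero (orderOf a) := ⟨hN.ne'⟩
  obtain ⟨k, -, rfl⟩ := hb.eq_pow_of_pow_eq_one ((mem_nthRootsFinset hN 1).1 hc)
  exact ⟨y, hy, k, fun h ↦ hcb (Subtype.ext h), hyc⟩

theorem Submonoid.finite_closure_pair_of_mul_eq_pow_mul {M : Type*} [Monoid M] {a y : M} {k : ℕ}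
    (ha : IsOfFinOrder a) (hy : IsOfFinOrder y) (h : y * a = a ^ k * y) :
    (Submonoid.closure {a, y} : Set M).Finite := by
  refine (ha.finite_powers.image2 (· * ·) hy.finite_powers).subset fun x hx ↦ ?_
  induction hx using Submonoid.closure_induction_left with
  | one => exact ⟨1, one_mem _, 1, one_mem _, mul_one 1⟩
  | mul_left g hg x hx ih =>
    obtain ⟨_, ⟨i, rfl⟩, _, ⟨j, rfl⟩, rfl⟩ := ih
    obtain rfl | rfl := hg
    · exact ⟨_, ⟨i + 1, rfl⟩, _, ⟨j, rfl⟩, by simp [pow_succ', mul_assoc]⟩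
    · refine ⟨_, ⟨k * i, rfl⟩, _, ⟨j + 1, rfl⟩, ?_⟩
      have := (SemiconjBy.pow_right (show SemiconjBy g a (a ^ k) from h) i).eq
      simp only [pow_succ', pow_mul]
      rw [← mul_assoc, ← this, mul_assoc]

namespace IsPotentRing

/-- **Jacobson's theorem** for division rings. -/
theorem commute_of_divisionRing {D : Type*} [DivisionRing D] (hD : IsPotentRing D) (v a : D) :
    Commute v a := by
  by_contra hv
  have ha : a ≠ 0 := by rintro rfl; exact hv (Commute.zero_right v)
  obtain ⟨y, hy, k, hk, h⟩ := exists_mul_eq_pow_mul_of_not_commute (hD.isOfFinOrder ha) hv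
  obtain ⟨c, hc, _⟩ := hD.exists_charP
  have : NeZero c := ⟨hc⟩
  let := ZMod.algebra D c
  let S := Algebra.adjoin (ZMod c) ({a, y} : Set D)
  have hfg : (Subalgebra.toSubmodule S).FG := by
    rw [Algebra.adjoin_eq_span]
    exact Submodule.fg_span (Submonoid.finite_closure_pair_of_mul_eq_pow_mul
      (hD.isOfFinOrder ha) (hD.isOfFinOrder hy) h)
  have : Module.Finite (ZMod c) S := Module.Finite.iff_fg.2 hfg
  have : Finite S := Module.finite_of_finite (ZMod c)
  have hcomm := (Finite.isDomain_to_isField S).mul_comm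
    ⟨y, Algebra.subset_adjoin (by simp)⟩ ⟨a, Algebra.subset_adjoin (by simp)⟩
  have hcomm : y * a = a * y := congrArg Subtype.val hcomm
  exact hk (mul_right_cancel₀ hy (h.symm.trans hcomm))

variable {R : Type*} [Ring R]

theorem commute_pow_succ (hR : IsPotentRing R) {x : R} {k : ℕ} (hk : x ^ (k + 2) = x) (r : R) :
    Commute (x ^ (k + 1)) r := by
  have := hR.isReduced
  set e := x ^ (k + 1) with he
  have hee : e * e = e := by
    rw [he, ← pow_add, show k + 1 + (k + 1) = k + 2 + k by ring, pow_add, hk, ← pow_succ']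
  have h1 : e * r - e * r * e = 0 := by
    refine pow_eq_zero_iff two_ne_zero |>.1 ?_
    have : (e * r - e * r * e) * e = 0 := by rw [sub_mul, mul_assoc _ e e, hee, sub_self]
    calc (e * r - e * r * e) ^ 2
        = (e * r - e * r * e) * e * (r - r * e) := by noncomm_ring
      _ = 0 := by rw [this, zero_mul]
  have h2 : r * e - e * r * e = 0 := by
    refine pow_eq_zero_iff two_ne_zero |>.1 ?_
    have : e * (r * e - e * r * e) = 0 := by
      rw [mul_sub, ← mul_assoc e (e * r) e, ← mul_assoc e e r, hee, mul_assoc, sub_self]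
    calc (r * e - e * r * e) ^ 2
        = (r - e * r) * (e * (r * e - e * r * e)) := by noncomm_ring
      _ = 0 := by rw [this, mul_zero]
  exact (sub_eq_zero.1 h1).trans (sub_eq_zero.1 h2).symm

theorem isTwoSided (hR : IsPotentRing R) (I : Ideal R) : I.IsTwoSided where
  mul_mem_of_left {x} r hx := by
    obtain ⟨k, hk⟩ := hR.exists_pow_add_two_eq x
    have : x * r = (x * r * x ^ k) * x := by
      rw [mul_assoc _ (x ^ k), ← pow_succ, mul_assoc, ← (hR.commute_pow_succ hk r).eq,
        ← mul_assoc, ← pow_succ', hk]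
    rw [this]
    exact I.mul_mem_left _ hx

/-- **Jacobson's theorem**: potent rings are commutative. -/
theorem mul_comm (hR : IsPotentRing R) (a b : R) : a * b = b * a := by
  by_contra hab
  set d := a * b - b * a with hd
  have hd0 : d ≠ 0 := sub_ne_zero.2 hab
  obtain ⟨k, hk⟩ := hR.exists_pow_add_two_eq d
  have hne : Ideal.span {1 - d ^ (k + 1)} ≠ ⊤ := by
    intro htop
    obtain ⟨r, hr⟩ := Ideal.mem_span_singleton'.1 ((Ideal.eq_top_iff_one _).1 htop)
    refine hd0 ?_
    calc d = r * (1 - d ^ (k + 1)) * d := by rw [hr, one_mul]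
      _ = r * (d - d ^ (k + 2)) := by rw [mul_assoc, sub_mul, one_mul, ← pow_succ]
      _ = 0 := by rw [hk, sub_self, mul_zero]
  obtain ⟨M, hM, hle⟩ := Ideal.exists_le_maximal _ hne
  have := hR.isTwoSided M
  have hdM : d ∉ M := fun hdM ↦ hM.ne_top <| (Ideal.eq_top_iff_one _).2 <| by
    have := M.add_mem (hle (Ideal.mem_span_singleton_self _)) (M.mul_mem_left (d ^ k) hdM)
    rwa [← pow_succ, sub_add_cancel] at this
  let := Ideal.Quotient.divisionRing M
  have hq : IsPotentRing (R ⧸ M) := hR.of_surjective _ Ideal.Quotient.mk_surjective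
  refine hdM (Ideal.Quotient.eq_zero_iff_mem.1 ?_)
  rw [hd, map_sub, map_mul, map_mul, sub_eq_zero]
  exact hq.commute_of_divisionRing _ _

end IsPotentRing

/-- A ring is *clean* if every element is the sum of an idempotent and a unit. -/
def IsCleanRing (R : Type*) [Ring R] : Prop :=
  ∀ x : R, ∃ e u : R, IsIdempotentElem e ∧ IsUnit u ∧ x = e + u

theorem IsPotentRing.isCleanRing {R : Type*} [CommRing R] (hR : IsPotentRing R) :
    IsCleanRing R := fun x ↦ by
  obtain ⟨k, hk⟩ := hR.exists_pow_add_two_eq x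
  have he : x ^ (k + 1) * x ^ (k + 1) = x ^ (k + 1) := by
    linear_combination x ^ k * hk
  refine ⟨1 - x ^ (k + 1), x - (1 - x ^ (k + 1)), IsIdempotentElem.one_sub he,
    IsUnit.of_mul_eq_one (x ^ k * x ^ (k + 1) - (1 - x ^ (k + 1))) ?_, by ring⟩
  linear_combination (x ^ k * x ^ k + 2 * x ^ k + 1) * hk

theorem IsCleanRing.matrix {R : Type*} [CommRing R] (hR : IsCleanRing R) (n : ℕ) :
    IsCleanRing (Matrix (Fin n) (Fin n) R) := by
  induction n with
  | zero =>
    exact fun A ↦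
      ⟨0, 0, IsIdempotentElem.zero, isUnit_of_subsingleton _, Subsingleton.elim _ _⟩
  | succ n ih =>
    intro A
    let φ : Matrix (Fin n ⊕ Fin 1) (Fin n ⊕ Fin 1) R ≃+* Matrix (Fin (n + 1)) (Fin (n + 1)) R :=
      (Matrix.reindexAlgEquiv R R finSumFinEquiv).toRingEquiv
    suffices h : ∀ B : Matrix (Fin n ⊕ Fin 1) (Fin n ⊕ Fin 1) R,
        ∃ E U, IsIdempotentElem E ∧ IsUnit U ∧ B = E + U by
      obtain ⟨E, U, hE, hU, h⟩ := h (φ.symm A)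
      refine ⟨φ E, φ U, hE.map φ, hU.map φ, ?_⟩
      rw [← map_add, ← h, φ.apply_symm_apply]
    intro B
    obtain ⟨E, U, hE, hU, h⟩ := ih B.toBlocks₁₁
    have := hU.invertible
    obtain ⟨e, u, he, hu, hx⟩ := hR ((B.toBlocks₂₂ - B.toBlocks₂₁ * ⅟U * B.toBlocks₁₂) 0 0)
    refine ⟨.fromBlocks E 0 0 (.diagonal fun _ ↦ e),
      .fromBlocks U B.toBlocks₁₂ B.toBlocks₂₁ (B.toBlocks₂₂ - .diagonal fun _ ↦ e), ?_, ?_, ?_⟩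
    · simp [IsIdempotentElem, Matrix.fromBlocks_multiply, hE.eq, he.eq]
    · rw [Matrix.isUnit_fromBlocks_iff_of_invertible₁₁, Matrix.isUnit_iff_isUnit_det,
        Matrix.det_fin_one]
      rw [Matrix.sub_apply] at hx
      convert hu using 1
      rw [Matrix.sub_apply, Matrix.sub_apply, Matrix.diagonal_apply_eq]
      linear_combination hx
    · rw [Matrix.fromBlocks_add, zero_add, zero_add, add_sub_cancel, ← h,
        Matrix.fromBlocks_toBlocks]

theorem IsPotentRing.exists_finite_subring {R : Type*} [CommRing R] (hR : IsPotentRing R)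
    {s : Set R} (hs : s.Finite) : ∃ S : Subring R, s ⊆ S ∧ Finite S := by
  obtain ⟨c, hc, _⟩ := hR.exists_charP
  have : NeZero c := ⟨hc⟩
  let := ZMod.algebra R c
  have hfg := fg_adjoin_of_finite (R := ZMod c) hs fun x _ ↦ by
    obtain ⟨k, hk⟩ := hR.exists_pow_add_two_eq x
    exact ⟨X ^ (k + 2) - X, monic_X_pow_sub (degree_X_le.trans_lt (by norm_cast; omega)),
      by simp [hk]⟩
  have : Module.Finite (ZMod c) (Algebra.adjoin (ZMod c) s) := Module.Finite.iff_fg.2 hfg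
  exact ⟨(Algebra.adjoin (ZMod c) s).toSubring, Algebra.subset_adjoin,
    Module.finite_of_finite (M := Algebra.adjoin (ZMod c) s) (ZMod c)⟩

theorem IsPotentRing.exists_matrix_eq_idempotent_add_potent {R : Type*} [CommRing R]
    (hR : IsPotentRing R) (n : ℕ) (A : Matrix (Fin n) (Fin n) R) :
    ∃ E P : Matrix (Fin n) (Fin n) R,
      A = E + P ∧ IsIdempotentElem E ∧ ∃ m : ℕ, 2 ≤ m ∧ P ^ m = P := by
  obtain ⟨S, hS, _⟩ := hR.exists_finite_subring
    (Set.finite_range fun ij : Fin n × Fin n ↦ A ij.1 ij.2)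
  let B : Matrix (Fin n) (Fin n) S := .of fun i j ↦ ⟨A i j, hS ⟨(i, j), rfl⟩⟩
  have hSp : IsPotentRing S := hR.of_injective S.subtype S.subtype_injective
  obtain ⟨E, U, hE, hU, h⟩ := hSp.isCleanRing.matrix n B
  obtain ⟨u, rfl⟩ := hU
  obtain ⟨N, hN, hu⟩ := isOfFinOrder_iff_pow_eq_one.1 (isOfFinOrder_of_finite u)
  let φ := S.subtype.mapMatrix (m := Fin n)
  refine ⟨φ E, φ u, ?_, hE.map φ, N + 1, by omega, ?_⟩
  · rw [← map_add, ← h]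
    rfl
  · rw [← map_pow, pow_succ, ← Units.val_pow_eq_pow_val, hu, Units.val_one, one_mul]

/-- If `R` is a potent ring, then every matrix in `Mₙ(R)` is the sum of a tripotent
and a potent, for all `n ≥ 1`. -/
theorem matrix_eq_tripotent_add_potent_of_potent (R : Type*) [Ring R]
    (hR : IsPotentRing R) (n : ℕ) (hn : 0 < n) (A : Matrix (Fin n) (Fin n) R) :
    ∃ T P : Matrix (Fin n) (Fin n) R,
      A = T + P ∧ T ^ 3 = T ∧ ∃ m : ℕ, 2 ≤ m ∧ P ^ m = P := by
  let : CommRing R := { ‹Ring R› with mul_comm := hR.mul_comm }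
  obtain ⟨E, P, h, hE, hP⟩ := hR.exists_matrix_eq_idempotent_add_potent n A
  exact ⟨E, P, h, hE.pow_succ_eq 2, hP⟩
end
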